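/- Let p be a prime number with p ≡ 1 (mod 8), and write p = y² + z² with integers y, z such that 4 divides y. Let s ∈ ℝ be the positive square root of p, let a ∈ ℝ be the positive square root of p + y·s, and set K = ℚ(a) ⊆ ℝ. Then the discriminant of the number field K equals p³. -/

import Mathlib

open Polynomial in
theorem minpoly_eq_of_root_eisenstein_quartic {K : Type*} [Field K] [Algebra ℚ K] {p : ℕ}
    (hp : p.Prime) {z : ℤ} (hz : ¬ (p : ℤ) ∣ z) {a : K} (ha : a ^ 4 - 2 * p * a ^ 2 + p * z ^ 2 = 0) :
    minpoly ℚ a = X ^ 4 - C (2 * p : ℚ) * X ^ 2 + C (p * z ^ 2 : ℚ) := by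
  have hpZ : Prime (p : ℤ) := Nat.prime_iff_prime_int.mp hp
  let f : ℤ[X] := X ^ 4 - C (2 * p : ℤ) * X ^ 2 + C (p * z ^ 2 : ℤ)
  have hdeg : f.natDegree = 4 := by simp only [f]; compute_degree!
  have hmonic : f.Monic := by simp only [f]; monicity!
  have hP : (Ideal.span {(p : ℤ)}).IsPrime := (Ideal.span_singleton_prime hpZ.ne_zero).mpr hpZ
  have hf0 : f.coeff 0 = p * z ^ 2 := by simp [f, coeff_X_pow, -map_mul, -map_pow, -eq_intCast]
  have hEis : f.IsEisensteinAt (Ideal.span {(p : ℤ)}) := by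
    refine ⟨?_, ?_, ?_⟩
    · rw [hmonic.leadingCoeff]
      exact (Ideal.ne_top_iff_one _).mp hP.ne_top
    · intro n hn
      rw [hdeg] at hn
      rw [Ideal.mem_span_singleton]
      interval_cases n <;> simp [f, coeff_X_pow, coeff_C, -map_mul, -map_pow, -eq_intCast]
    · rw [Ideal.span_singleton_pow, Ideal.mem_span_singleton, hf0, pow_two,
        mul_dvd_mul_iff_left hpZ.ne_zero]
      exact fun h => hz (hpZ.dvd_of_dvd_pow h)
  have hirr : Irreducible f := hEis.irreducible hP hmonic.isPrimitive (by omega)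
  have hmap : f.map (Int.castRingHom ℚ) = X ^ 4 - C (2 * p : ℚ) * X ^ 2 + C (p * z ^ 2 : ℚ) := by
    simp [f, Polynomial.map_sub, -map_mul, -map_pow, -eq_intCast]
  rw [← hmap]
  refine (minpoly.eq_of_irreducible_of_monic
    ((IsPrimitive.Int.irreducible_iff_irreducible_map_cast hmonic.isPrimitive).mp hirr)
    ?_ (hmonic.map _)).symm
  rw [hmap]
  simpa using ha

theorem Algebra.trace_eq_zero_of_algEquiv_eq_neg {F K : Type*} [Field F] [CharZero F]
    [Field K] [Algebra F K] (σ : K ≃ₐ[F] K) {x : K} (hx : σ x = -x) :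
    Algebra.trace F K x = 0 := by
  have h := Algebra.trace_eq_of_algEquiv σ x
  rw [hx, map_neg] at h
  exact self_eq_neg.mp h.symm

namespace NumberField

open scoped Matrix in
/-- The discriminant of a family of algebraic integers of full cardinality is the field
discriminant times the square of the index. -/
theorem exists_discr_eq_sq_mul_discr {K : Type*} [Field K] [NumberField K] {ι : Type*} [Fintype ι]
    [DecidableEq ι] {b : ι → K} (hb : ∀ i, IsIntegral ℤ (b i))
    (hcard : Fintype.card ι = Module.finrank ℚ K) :
    ∃ m : ℤ, Algebra.discr ℚ b = m ^ 2 * discr K := by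
  classical
  let e : Module.Free.ChooseBasisIndex ℤ (𝓞 K) ≃ ι := Fintype.equivOfCardEq (by
    rw [hcard, Module.finrank_eq_card_basis (integralBasis K)])
  let ω := (integralBasis K).reindex e
  let P : Matrix ι ι ℤ := Matrix.of fun i j =>
    (RingOfIntegers.basis K).repr ⟨b j, hb j⟩ (e.symm i)
  have hP : b = ω ᵥ* (P.map (Int.castRingHom ℚ)).map (algebraMap ℚ K) := by
    ext j
    have h := ω.sum_repr (b j)
    rw [← h]
    simp only [Matrix.vecMul, dotProduct]
    refine Finset.sum_congr rfl fun i _ => ?_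
    have h2 := integralBasis_repr_apply K ⟨b j, hb j⟩ (e.symm i)
    have h3 : ω.repr (b j) i = (P i j : ℚ) := by
      rw [Module.Basis.repr_reindex_apply]
      exact h2
    rw [h3, Algebra.smul_def, mul_comm]
    simp
  refine ⟨P.det, ?_⟩
  rw [hP, Algebra.discr_of_matrix_vecMul, coe_discr, Module.Basis.coe_reindex, Algebra.discr_reindex]
  congr 2
  exact (RingHom.map_det (Int.castRingHom ℚ) P).symm

/-- If every prime above `p` has ramification index at least `e`, then `p ^ (e - 1)` divides the
discriminant. -/
theorem pow_dvd_discr_of_forall_mem_pow {K : Type*} [Field K] [NumberField K] {p : ℕ}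
    (hp : p.Prime) {e : ℕ} (h : ∀ P : Ideal (𝓞 K), P.IsPrime → (p : 𝓞 K) ∈ P → (p : 𝓞 K) ∈ P ^ e) :
    (p : ℤ) ^ (e - 1) ∣ discr K := by
  have hpZ : Prime (p : ℤ) := Nat.prime_iff_prime_int.mp hp
  have hmax : (Ideal.span {(p : ℤ)}).IsMaximal :=
    ((Ideal.span_singleton_prime hpZ.ne_zero).mpr hpZ).isMaximal (by simpa using hpZ.ne_zero)
  obtain ⟨P, hP, hPp⟩ := Ideal.exists_ideal_over_maximal_of_isIntegral (S := 𝓞 K)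
    (Ideal.span {(p : ℤ)}) (by
      rw [(RingHom.injective_iff_ker_eq_bot _).mp (FaithfulSMul.algebraMap_injective ℤ (𝓞 K))]
      exact bot_le)
  have hmem : (p : 𝓞 K) ∈ P := by
    have : (p : ℤ) ∈ P.comap (algebraMap ℤ (𝓞 K)) := hPp ▸ Ideal.mem_span_singleton_self _
    simpa using this
  have hdvd : P ^ (e - 1) ∣ differentIdeal ℤ (𝓞 K) := by
    refine pow_sub_one_dvd_differentIdeal ℤ (p := Ideal.span {(p : ℤ)}) P e
      (by simpa using hpZ.ne_zero) ?_
    rw [Ideal.dvd_iff_le, Ideal.map_span, Set.image_singleton, Ideal.span_singleton_le_iff_mem]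
    simpa using h P hP.isPrime hmem
  have hN : p ∣ P.absNorm := by
    have h1 : (P.absNorm : 𝓞 K) ∈ P := Ideal.absNorm_mem P
    have : (P.absNorm : ℤ) ∈ P.comap (algebraMap ℤ (𝓞 K)) := by simpa using h1
    rw [hPp, Ideal.mem_span_singleton] at this
    exact_mod_cast this
  have := (pow_dvd_pow_of_dvd hN (e - 1)).trans (by
    simpa using map_dvd Ideal.absNorm hdvd)
  rw [absNorm_differentIdeal (K := K)] at this
  rw [← Int.natCast_dvd] at this
  exact_mod_cast this

end NumberField

theorem Ideal.natCast_mem_pow_four {R : Type*} [CommRing R] {P : Ideal R} [P.IsPrime] {p : ℕ}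
    {y : ℤ} (hy : IsCoprime (p : ℤ) y) {s a : R} (hs : s ^ 2 = p) (ha : a ^ 2 = p + y * s)
    (hP : (p : R) ∈ P) : (p : R) ∈ P ^ 4 := by
  have hsP : s ∈ P := Ideal.IsPrime.mem_of_pow_mem ‹_› 2 (hs ▸ hP)
  have haP : a ∈ P := Ideal.IsPrime.mem_of_pow_mem ‹_› 2
    (ha ▸ P.add_mem hP (P.mul_mem_left _ hsP))
  have hs2 : s ^ 2 ∈ P ^ 2 := Ideal.pow_mem_pow hsP 2
  have ha2 : a ^ 2 ∈ P ^ 2 := Ideal.pow_mem_pow haP 2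
  obtain ⟨u, v, huv⟩ := hy
  have hs' : s = (u * s) * s ^ 2 + v * (a ^ 2 - s ^ 2) := by
    have : (u * p + v * y : R) = 1 := by exact_mod_cast congrArg (Int.cast : ℤ → R) huv
    linear_combination (-s) * this + (v - u * s) * hs - v * ha
  have hsP2 : s ∈ P ^ 2 := hs' ▸ (P ^ 2).add_mem (Ideal.mul_mem_left _ _ hs2)
    (Ideal.mul_mem_left _ _ ((P ^ 2).sub_mem ha2 hs2))
  rw [← hs, show 4 = 2 * 2 from rfl, pow_mul]
  exact Ideal.pow_mem_pow hsP2 2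

open Polynomial in
theorem IsIntegral.of_sq_eq_mul_add {R A : Type*} [CommRing R] [CommRing A] [Algebra R A]
    {x c d : A} (hc : IsIntegral R c) (hd : IsIntegral R d) (h : x ^ 2 = c * x + d) :
    IsIntegral R x := by
  nontriviality A
  let c' : integralClosure R A := ⟨c, hc⟩
  let d' : integralClosure R A := ⟨d, hd⟩
  refine isIntegral_trans (A := integralClosure R A) x ⟨X ^ 2 - C c' * X - C d', ?_, ?_⟩
  · monicity!
  · have hc' : algebraMap (integralClosure R A) A c' = c := rfl
    have hd' : algebraMap (integralClosure R A) A d' = d := rfl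
    simp [hc', hd', h]

open scoped Matrix in
theorem NumberField.discr_eq_pow_three_of_powerBasis {K : Type*} [Field K] [NumberField K]
    (pb : PowerBasis ℚ K) {p : ℕ} (hp : p.Prime) {y z : ℤ} (hpyz : (p : ℤ) = y ^ 2 + z ^ 2)
    (hy : 4 ∣ y)
    (hz : z % 4 = 1) {s b : K} (hs : s ^ 2 = p) (ha : pb.gen ^ 2 = p + y * s)
    (hb : pb.gen * b = s * z) : NumberField.discr K = (p : ℤ) ^ 3 := by
  have hpZ : Prime (p : ℤ) := Nat.prime_iff_prime_int.mp hp
  have hy0 : y ≠ 0 := by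
    rintro rfl
    exact hpZ.irreducible.not_isSquare ⟨z, by linear_combination hpyz⟩
  have hpz : ¬ (p : ℤ) ∣ z := by
    intro h
    have h2 : (p : ℤ) ∣ y := hpZ.dvd_of_dvd_pow (n := 2) (by
      rw [show y ^ 2 = p - z * z by linear_combination -hpyz]
      exact dvd_sub_self_left.mpr (h.mul_right z))
    obtain ⟨c, rfl⟩ := h
    obtain ⟨d, rfl⟩ := h2
    refine hpZ.not_isUnit (IsUnit.of_mul_eq_one (d ^ 2 + c ^ 2) ?_)
    apply mul_left_cancel₀ hpZ.ne_zero
    linear_combination -hpyz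
  have hpy : ¬ (p : ℤ) ∣ y := by
    intro h
    refine hpz (hpZ.dvd_of_dvd_pow (n := 2) ?_)
    rw [show z ^ 2 = p - y * y by linear_combination -hpyz]
    exact dvd_sub_self_left.mpr (h.mul_right y)
  have hp0 : (p : K) ≠ 0 := by exact_mod_cast hp.ne_zero
  have hyK : (y : K) ≠ 0 := by exact_mod_cast hy0
  have hpyzK : (p : K) = y ^ 2 + z ^ 2 := by exact_mod_cast congrArg (Int.cast : ℤ → K) hpyz
  set a := pb.gen with ha_def
  have hmin := minpoly_eq_of_root_eisenstein_quartic hp hpz (a := a) (by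
    linear_combination (a ^ 2 - p + y * s) * ha + y ^ 2 * hs - p * hpyzK)
  have hfin : Module.finrank ℚ K = 4 := by
    rw [pb.finrank, ← pb.natDegree_minpoly, ← ha_def, hmin]
    compute_degree!
  have ha0 : a ≠ 0 := by
    intro h0
    have h4 : a ^ 4 - 2 * p * a ^ 2 + p * z ^ 2 = 0 := by
      linear_combination (a ^ 2 - p + y * s) * ha + y ^ 2 * hs - p * hpyzK
    rw [h0] at h4
    have hzK : (z : K) ≠ 0 := by
      have : z ≠ 0 := by rintro rfl; simp at hz
      exact_mod_cast this
    simp [hp0, hzK] at h4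
  have hb2 : b ^ 2 = p - y * s := by
    apply mul_left_cancel₀ (pow_ne_zero 2 ha0)
    linear_combination (a * b + s * z) * hb + z ^ 2 * hs - (p - y * s) * ha - p * hpyzK +
      y ^ 2 * hs
  have hroot : Polynomial.aeval b (minpoly ℚ pb.gen) = 0 := by
    rw [← ha_def, hmin]
    simp only [map_add, map_sub, map_mul, map_pow, Polynomial.aeval_X, map_ofNat, map_natCast,
      map_intCast]
    linear_combination (b ^ 2 - p - y * s) * hb2 + y ^ 2 * hs - p * hpyzK
  let φ : K →ₐ[ℚ] K := pb.lift b hroot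
  let σ : K ≃ₐ[ℚ] K := AlgEquiv.ofBijective φ (Algebra.IsAlgebraic.algHom_bijective φ)
  have hσa : σ a = b := pb.lift_gen b hroot
  have hσs : σ s = -s := by
    have h := congrArg σ ha
    simp only [map_pow, map_add, map_mul, map_natCast, map_intCast, hσa] at h
    apply mul_left_cancel₀ hyK
    linear_combination hb2 - h
  have hb0 : b ≠ 0 := by
    intro h
    exact ha0 (σ.injective (by rw [hσa, h, map_zero]))
  have hσb : σ b = -a := by
    have h := congrArg σ hb
    simp only [map_mul, map_intCast, hσa, hσs] at h
    apply mul_left_cancel₀ hb0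
    linear_combination h + hb
  have hts : Algebra.trace ℚ K s = 0 := Algebra.trace_eq_zero_of_algEquiv_eq_neg σ hσs
  have hτ : ∀ x, σ (σ x) = -x → Algebra.trace ℚ K x = 0 := fun x hx =>
    Algebra.trace_eq_zero_of_algEquiv_eq_neg (σ.trans σ) hx
  have hta := hτ a (by rw [hσa, hσb])
  have htb := hτ b (by rw [hσb, map_neg, hσa])
  have htsa := hτ (s * a) (by simp [hσa, hσb, hσs])
  have htsb := hτ (s * b) (by simp [hσa, hσb, hσs])
  have htr (q : ℚ) : Algebra.trace ℚ K (algebraMap ℚ K q) = 4 * q := by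
    rw [Algebra.trace_algebraMap, hfin]; simp
  have ht1 : Algebra.trace ℚ K 1 = 4 := by simpa using htr 1
  have htp : Algebra.trace ℚ K p = 4 * p := by simpa using htr p
  have htys (c : ℤ) : Algebra.trace ℚ K (c * s) = 0 := by
    rw [← zsmul_eq_mul, map_zsmul, hts, smul_zero]
  have hdiag : Algebra.discr ℚ ![1, s, a, b] = 256 * p ^ 3 := by
    have : Algebra.traceMatrix ℚ ![1, s, a, b] =
        Matrix.diagonal ![4, 4 * (p : ℚ), 4 * p, 4 * p] := by
      have e1 : s * s = p := by rw [← hs, pow_two]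
      have e2 : a * a = p + y * s := by rw [← ha, pow_two]
      have e3 : b * b = p - y * s := by rw [← hb2, pow_two]
      have e4 : a * b = z * s := by rw [hb, mul_comm]
      ext i j
      fin_cases i <;> fin_cases j <;>
        simp [Algebra.traceMatrix_apply, Algebra.traceForm_apply, e1, e2, e3, e4,
          mul_comm b a, mul_comm a s, mul_comm b s, hts, hta, htb, htsa, htsb, ht1, htp, htys]
    rw [Algebra.discr_def, this, Matrix.det_diagonal]
    simp [Fin.prod_univ_four]
    ring
  let M : Matrix (Fin 4) (Fin 4) ℚ :=
    !![1, 0, 0, 0; 1/2, 1/2, 0, 0; 1/4, 1/4, 1/4, 1/4; 1/4, -1/4, 1/4, -1/4]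
  have hM : M.det = -1/16 := by
    simp [M, Matrix.det_succ_row_zero, Fin.sum_univ_succ]
    norm_num
  let v := M.map (algebraMap ℚ K) *ᵥ ![1, s, a, b]
  have hv : Algebra.discr ℚ v = p ^ 3 := by
    rw [Algebra.discr_of_matrix_mulVec, hdiag, hM]
    ring
  have hint : ∀ i, IsIntegral ℤ (v i) := by
    obtain ⟨n, rfl⟩ := hy
    obtain ⟨m, rfl⟩ : ∃ m, z = 4 * m + 1 := ⟨z / 4, by omega⟩
    push_cast at *
    have hx : IsIntegral ℤ ((1 + s) / 2) :=
      .of_sq_eq_mul_add isIntegral_one (isIntegral_intCast (4 * n ^ 2 + 4 * m ^ 2 + 2 * m)) (by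
        push_cast
        linear_combination (hs + hpyzK) / 4)
    have hm (c d : ℤ) : IsIntegral ℤ ((c : K) + d * ((1 + s) / 2)) :=
      (isIntegral_intCast _).add ((isIntegral_intCast _).mul hx)
    intro i
    fin_cases i
    · simpa [v, M, Matrix.mulVec, dotProduct, Fin.sum_univ_four] using isIntegral_one
    · convert hx using 1
      simp [v, M, Matrix.mulVec, dotProduct, Fin.sum_univ_four]
      ring
    · refine .of_sq_eq_mul_add hx (hm (n ^ 2 + m ^ 2) m) ?_
      simp [v, M, Matrix.mulVec, dotProduct, Fin.sum_univ_four]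
      linear_combination (-hs + ha + hb2 + 2 * hb + hpyzK) / 16
    · refine .of_sq_eq_mul_add (hm 1 (-1)) (hm (n ^ 2 + m ^ 2 + m) (-m)) ?_
      simp [v, M, Matrix.mulVec, dotProduct, Fin.sum_univ_four]
      linear_combination (-hs + ha + hb2 - 2 * hb + hpyzK) / 16
  obtain ⟨m, hm⟩ := NumberField.exists_discr_eq_sq_mul_discr hint (by rw [hfin]; rfl)
  have hm' : (p : ℤ) ^ 3 = m ^ 2 * NumberField.discr K := by rw [hv] at hm; exact_mod_cast hm
  have hdvd : (p : ℤ) ^ (4 - 1) ∣ NumberField.discr K := by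
    refine NumberField.pow_dvd_discr_of_forall_mem_pow hp fun P hP hpP => ?_
    have hsi : IsIntegral ℤ s := .of_pow two_pos (by rw [hs]; exact isIntegral_natCast _)
    have hai : IsIntegral ℤ a := .of_pow two_pos (by
      rw [ha]; exact (isIntegral_natCast _).add ((isIntegral_intCast _).mul hsi))
    obtain ⟨s', hs'⟩ : ∃ s' : NumberField.RingOfIntegers K, (s' : K) = s := ⟨⟨s, hsi⟩, rfl⟩
    obtain ⟨a', ha'⟩ : ∃ a' : NumberField.RingOfIntegers K, (a' : K) = a := ⟨⟨a, hai⟩, rfl⟩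
    refine Ideal.natCast_mem_pow_four (s := s') (a := a')
      ((Prime.coprime_iff_not_dvd hpZ).mpr hpy) ?_ ?_ hpP
    · apply NumberField.RingOfIntegers.coe_injective
      simpa [hs'] using hs
    · apply NumberField.RingOfIntegers.coe_injective
      simpa [hs', ha'] using ha
  have hp3 : 0 < (p : ℤ) ^ 3 := pow_pos (by exact_mod_cast hp.pos) 3
  have hD : 0 ≤ NumberField.discr K := by
    by_contra! h
    nlinarith [mul_nonneg (sq_nonneg m) (neg_pos.mpr h).le]
  exact Int.dvd_antisymm hD hp3.le ⟨m ^ 2, by rw [hm', mul_comm]⟩ hdvd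

/-- Proposition 4.5(ii) (discriminantprop), case `l_i = l_j`: for a prime
`p ≡ 1 (mod 8)` written as `p = y² + z²` with `4 ∣ y`, the totally real cyclic
quartic field `K = ℚ(√(p + y√p)) ⊆ ℝ` has absolute discriminant `p³`. -/
theorem discr_cyclic_quartic_field_eq
    (p : ℕ) (hp : p.Prime) (hp8 : p % 8 = 1)
    (y z : ℤ) (hpyz : (p : ℤ) = y ^ 2 + z ^ 2) (hy : 4 ∣ y)
    (s : ℝ) (hs : s = Real.sqrt p)
    (a : ℝ) (ha : a = Real.sqrt (p + y * s))
    (K : IntermediateField ℚ ℝ)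
    (hK : K = IntermediateField.adjoin ℚ {a})
    [NumberField K] :
    NumberField.discr K = (p : ℤ) ^ 3 := by
  subst hK
  have hs2 : s ^ 2 = p := by rw [hs, Real.sq_sqrt p.cast_nonneg]
  have hz2 : ¬ 2 ∣ z := by
    intro h
    have : (2 : ℤ) ∣ p := hpyz ▸ dvd_add ((dvd_trans (by norm_num) hy).pow two_ne_zero)
      (h.pow two_ne_zero)
    omega
  obtain ⟨w, hw4, hwz⟩ : ∃ w : ℤ, w % 4 = 1 ∧ w ^ 2 = z ^ 2 := by
    rcases (by omega : z % 4 = 1 ∨ -z % 4 = 1) with h | h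
    exacts [⟨z, h, rfl⟩, ⟨-z, h, neg_sq z⟩]
  have hy0 : y ≠ 0 := by
    rintro rfl
    exact (Nat.prime_iff_prime_int.mp hp).irreducible.not_isSquare
      ⟨z, by linear_combination hpyz⟩
  have hp0 : (0 : ℝ) < p := by exact_mod_cast hp.pos
  have hyp : (y : ℝ) ^ 2 < p := by
    have : y ^ 2 < p := by
      have hz0 : z ≠ 0 := by rintro rfl; exact hz2 (dvd_zero 2)
      have : 0 < z ^ 2 := by positivity
      omega
    exact_mod_cast this
  have hpos : 0 < p + y * s := by
    have := abs_lt_of_sq_lt_sq (a := y * s) (b := p) (by rw [mul_pow, hs2]; nlinarith) hp0.le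
    linarith [(abs_lt.mp this).1]
  have ha2 : a ^ 2 = p + y * s := by rw [ha, Real.sq_sqrt hpos.le]
  have ha0 : a ≠ 0 := by rintro rfl; simp [hpos.ne] at ha2
  have hyR : (y : ℝ) ≠ 0 := by exact_mod_cast hy0
  have hsint : IsIntegral ℚ s := .of_pow two_pos (by rw [hs2]; exact isIntegral_natCast _)
  have haint : IsIntegral ℚ a := .of_pow two_pos (by
    rw [ha2]; exact (isIntegral_natCast _).add ((isIntegral_intCast _).mul hsint))
  let g := IntermediateField.AdjoinSimple.gen ℚ a
  have hg : (g : ℝ) = a := IntermediateField.AdjoinSimple.coe_gen ℚ a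
  have hg0 : g ≠ 0 := by
    intro h
    exact ha0 (by rw [← hg, h]; rfl)
  have hyK : (y : IntermediateField.adjoin ℚ {a}) ≠ 0 := by exact_mod_cast hy0
  refine NumberField.discr_eq_pow_three_of_powerBasis (IntermediateField.adjoin.powerBasis haint)
    hp (hwz ▸ hpyz) hy hw4 (s := (g ^ 2 - p) / y) (b := (g ^ 2 - p) / y * w / g) ?_ ?_ ?_
  · apply Subtype.ext
    push_cast
    rw [hg, ha2, add_sub_cancel_left, mul_div_cancel_left₀ _ hyR, hs2]
  · rw [IntermediateField.adjoin.powerBasis_gen, mul_div_cancel₀ _ hyK]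
    ring
  · rw [IntermediateField.adjoin.powerBasis_gen, mul_div_cancel₀ _ hg0]
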